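/- Let G be the circulant graph C_37[1,10,11]. If φ1 and φ2 are proper 5-colorings of G each of which contains a good 4-template (possibly different good 4-templates for φ1 and φ2), then φ1 and φ2 are Kempe 5-equivalent. -/

import Mathlib

namespace KempePaper

variable {V : Type*}

/-- A proper `k`-coloring: adjacent vertices receive distinct colors. -/
def Proper (G : SimpleGraph V) {k : ℕ} (c : V → Fin k) : Prop :=
  ∀ ⦃u v : V⦄, G.Adj u v → c u ≠ c v

/-- The subgraph of `G` induced by the vertices colored `α` or `β` under `c`
(as a graph on all of `V`, with edges only between such vertices). -/
def kempeGraph (G : SimpleGraph V) {k : ℕ} (c : V → Fin k) (α β : Fin k) :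
    SimpleGraph V :=
  SimpleGraph.fromRel (fun u v =>
    G.Adj u v ∧ (c u = α ∨ c u = β) ∧ (c v = α ∨ c v = β))

/-- `c₂` is obtained from `c₁` by a single Kempe swap: the colors `α` and `β`
are interchanged on the connected component (of the subgraph induced by the
vertices colored `α` or `β`) containing some vertex `w`, and nothing else changes. -/
def KempeStep (G : SimpleGraph V) {k : ℕ} (c₁ c₂ : V → Fin k) : Prop :=
  ∃ (α β : Fin k) (w : V),
    (∀ v : V, (kempeGraph G c₁ α β).Reachable w v → c₂ v = Equiv.swap α β (c₁ v)) ∧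
    (∀ v : V, ¬ (kempeGraph G c₁ α β).Reachable w v → c₂ v = c₁ v)

/-- Two `k`-colorings are Kempe `k`-equivalent if one can be obtained from the
other by a finite sequence of Kempe swaps. -/
def KempeEquiv (G : SimpleGraph V) {k : ℕ} (c₁ c₂ : V → Fin k) : Prop :=
  Relation.ReflTransGen (KempeStep G) c₁ c₂

/-- The triangulated toroidal grid `T[a×b]`. -/
def triGrid (a b : ℕ) : SimpleGraph (ZMod a × ZMod b) :=
  SimpleGraph.fromRel (fun u v =>
    u - v ∈ ({(0,1), (0,-1), (1,0), (-1,0), (1,-1), (-1,1)} : Set (ZMod a × ZMod b)))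

/-- `G` is `d`-degenerate: every nonempty finite set `S` of vertices contains a
vertex with at most `d` neighbors inside `S`. -/
def Degenerate (G : SimpleGraph V) (d : ℕ) : Prop :=
  ∀ S : Set V, S.Finite → S.Nonempty → ∃ v ∈ S, (S ∩ G.neighborSet v).ncard ≤ d

/-- `S` is an independent set in `G`. -/
def Indep (G : SimpleGraph V) (S : Set V) : Prop :=
  ∀ u ∈ S, ∀ v ∈ S, ¬ G.Adj u v

/-- The relation identifying all the vertices of `S`. -/
def identifyRel (S : Set V) (u v : V) : Prop :=
  u = v ∨ (u ∈ S ∧ v ∈ S)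

/-- The identification `G/S`: the vertices of `S` are merged into a single vertex,
and two distinct resulting vertices are adjacent iff some representatives are
adjacent in `G`. -/
def Identify (G : SimpleGraph V) (S : Set V) :
    SimpleGraph (Quot (identifyRel S)) :=
  SimpleGraph.fromRel (fun x y =>
    ∃ u v : V, Quot.mk (identifyRel S) u = x ∧ Quot.mk (identifyRel S) v = y ∧ G.Adj u v)

/-- A good 4-template: an independent set of exactly 4 vertices whose
identification yields a 4-degenerate graph. -/
def GoodFourTemplate (G : SimpleGraph V) (S : Set V) : Prop :=
  Indep G S ∧ S.ncard = 4 ∧ Degenerate (Identify G S) 4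

/-- A coloring is monochromatic on `S`. -/
def Mono {k : ℕ} (c : V → Fin k) (S : Set V) : Prop :=
  ∀ u ∈ S, ∀ v ∈ S, c u = c v

/-- `φ` is nice: it is Kempe 5-equivalent to a proper 5-coloring of `T[a×b]`
containing a good 4-template. -/
def Nice (a b : ℕ) (c : ZMod a × ZMod b → Fin 5) : Prop :=
  ∃ c' : ZMod a × ZMod b → Fin 5,
    Proper (triGrid a b) c' ∧ KempeEquiv (triGrid a b) c c' ∧
    ∃ S : Set (ZMod a × ZMod b), GoodFourTemplate (triGrid a b) S ∧ Mono c' S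

/-- The relation identifying the vertices within each color of the template `T`. -/
def contractRel (T : Set (Set V)) (u v : V) : Prop :=
  u = v ∨ ∃ C ∈ T, u ∈ C ∧ v ∈ C

/-- The contraction `G_T`: the vertices within each color of `T` are identified,
and two distinct resulting vertices are adjacent iff some representatives are
adjacent in `G`. -/
def Contract (G : SimpleGraph V) (T : Set (Set V)) :
    SimpleGraph (Quot (contractRel T)) :=
  SimpleGraph.fromRel (fun x y =>
    ∃ u v : V, Quot.mk (contractRel T) u = x ∧ Quot.mk (contractRel T) v = y ∧ G.Adj u v)

/-- `T` is a template in `G`: a finite collection of pairwise disjoint nonempty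
independent sets of vertices. -/
def IsTemplate (G : SimpleGraph V) (T : Set (Set V)) : Prop :=
  T.Finite ∧ (∀ C ∈ T, C.Nonempty) ∧ T.Pairwise (fun C D => Disjoint C D) ∧
    ∀ C ∈ T, Indep G C

/-- A coloring contains the template `T` if each color of `T` is monochromatic. -/
def ContainsTemplate {k : ℕ} (c : V → Fin k) (T : Set (Set V)) : Prop :=
  ∀ C ∈ T, Mono c C


/-- The circulant graph `C₃₇[1,10,11]`. -/
def circulant37 : SimpleGraph (ZMod 37) :=
  SimpleGraph.fromRel (fun u v =>
    u - v ∈ ({1, -1, 10, -10, 11, -11} : Set (ZMod 37)))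

/-! ### Swapping two colors on a closed set of vertices -/

/-- Exchange the colors `α` and `β` at the vertices of `U`. -/
noncomputable def swapOn {k : ℕ} (c : V → Fin k) (α β : Fin k) (U : Set V) : V → Fin k :=
  open Classical in fun v => if v ∈ U then Equiv.swap α β (c v) else c v

/-- `U` is a union of components of the subgraph induced by the colors `α` and `β`. -/
def KempeClosed (G : SimpleGraph V) {k : ℕ} (c : V → Fin k) (α β : Fin k) (U : Set V) : Prop :=
  ∀ ⦃u v⦄, G.Adj u v → (c u = α ∨ c u = β) → (c v = α ∨ c v = β) → u ∈ U → v ∈ U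

section Kempe

variable {G H : SimpleGraph V} {k : ℕ} {c : V → Fin k} {α β : Fin k} {U : Set V}

lemma swapOn_of_mem {v : V} (h : v ∈ U) : swapOn c α β U v = Equiv.swap α β (c v) := by
  simp [swapOn, h]

lemma swapOn_of_notMem {v : V} (h : v ∉ U) : swapOn c α β U v = c v := by
  simp [swapOn, h]

lemma swap_eq_or_iff (x : Fin k) :
    (Equiv.swap α β x = α ∨ Equiv.swap α β x = β) ↔ (x = α ∨ x = β) := by
  rw [Equiv.swap_apply_eq_iff, Equiv.swap_apply_eq_iff, Equiv.swap_apply_left,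
    Equiv.swap_apply_right, or_comm]

lemma swapOn_eq_or_iff (v : V) :
    (swapOn c α β U v = α ∨ swapOn c α β U v = β) ↔ (c v = α ∨ c v = β) := by
  by_cases h : v ∈ U
  · rw [swapOn_of_mem h, swap_eq_or_iff]
  · rw [swapOn_of_notMem h]

lemma kempeGraph_adj {u v : V} :
    (kempeGraph G c α β).Adj u v ↔ G.Adj u v ∧ (c u = α ∨ c u = β) ∧ (c v = α ∨ c v = β) := by
  simp only [kempeGraph, SimpleGraph.fromRel_adj]
  constructor
  · rintro ⟨-, h | ⟨h, h₁, h₂⟩⟩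
    exacts [h, ⟨h.symm, h₂, h₁⟩]
  · exact fun h => ⟨h.1.ne, Or.inl h⟩

lemma kempeGraph_swapOn :
    kempeGraph G (swapOn c α β U) α β = kempeGraph G c α β := by
  ext u v
  simp only [kempeGraph_adj, swapOn_eq_or_iff]

lemma kempeClosed_iff : KempeClosed G c α β U ↔
    ∀ u v, (kempeGraph G c α β).Reachable u v → u ∈ U → v ∈ U := by
  constructor
  · rintro h u v ⟨p⟩
    induction p with
    | nil => exact id
    | cons hadj _ ih =>
      obtain ⟨h₁, h₂, h₃⟩ := kempeGraph_adj.1 hadj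
      exact fun hu => ih (h h₁ h₂ h₃ hu)
  · exact fun h u v h₁ h₂ h₃ hu =>
      h u v (SimpleGraph.Adj.reachable (kempeGraph_adj.2 ⟨h₁, h₂, h₃⟩)) hu

/-- The vertices of the Kempe component of `w`. -/
def kempeComponent (G : SimpleGraph V) {k : ℕ} (c : V → Fin k) (α β : Fin k) (w : V) : Set V :=
  {v | (kempeGraph G c α β).Reachable w v}

lemma kempeClosed_kempeComponent (w : V) :
    KempeClosed G c α β (kempeComponent G c α β w) :=
  kempeClosed_iff.2 fun _ _ h hu => SimpleGraph.Reachable.trans hu h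

lemma kempeStep_iff {c₁ c₂ : V → Fin k} : KempeStep G c₁ c₂ ↔
    ∃ α β w, c₂ = swapOn c₁ α β (kempeComponent G c₁ α β w) := by
  constructor
  · rintro ⟨α, β, w, h₁, h₂⟩
    refine ⟨α, β, w, funext fun v => ?_⟩
    by_cases hv : v ∈ kempeComponent G c₁ α β w
    · rw [swapOn_of_mem hv, h₁ v hv]
    · rw [swapOn_of_notMem hv, h₂ v hv]
  · rintro ⟨α, β, w, rfl⟩
    exact ⟨α, β, w, fun v hv => swapOn_of_mem hv, fun v hv => swapOn_of_notMem hv⟩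

lemma KempeStep.symm {c₁ c₂ : V → Fin k} (h : KempeStep G c₁ c₂) : KempeStep G c₂ c₁ := by
  obtain ⟨α, β, w, rfl⟩ := kempeStep_iff.1 h
  refine kempeStep_iff.2 ⟨α, β, w, funext fun v => ?_⟩
  have hK : kempeComponent G (swapOn c₁ α β (kempeComponent G c₁ α β w)) α β w =
      kempeComponent G c₁ α β w := by
    simp only [kempeComponent, kempeGraph_swapOn]
  rw [hK]
  by_cases hv : v ∈ kempeComponent G c₁ α β w
  · rw [swapOn_of_mem hv, swapOn_of_mem hv, Equiv.swap_apply_self]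
  · rw [swapOn_of_notMem hv, swapOn_of_notMem hv]

lemma KempeEquiv.symm {c₁ c₂ : V → Fin k} (h : KempeEquiv G c₁ c₂) : KempeEquiv G c₂ c₁ := by
  induction h with
  | refl => exact .refl
  | tail _ hs ih => exact .head hs.symm ih

lemma KempeClosed.kempeEquiv [Finite V] (hU : KempeClosed G c α β U) :
    KempeEquiv G c (swapOn c α β U) := by
  induction hn : U.ncard using Nat.strong_induction_on generalizing c U with
  | _ n ih =>
    rcases U.eq_empty_or_nonempty with rfl | ⟨w, hw⟩
    · rw [show swapOn c α β ∅ = c from funext fun v => swapOn_of_notMem (Set.notMem_empty v)]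
      exact .refl
    · set K := kempeComponent G c α β w with hK
      have hwK : w ∈ K := SimpleGraph.Reachable.refl w
      have hKU : K ⊆ U := fun v hv => kempeClosed_iff.1 hU w v hv hw
      have hclosed : KempeClosed G (swapOn c α β K) α β (U \ K) := by
        rw [kempeClosed_iff, kempeGraph_swapOn]
        exact fun u v h hu => ⟨kempeClosed_iff.1 hU u v h hu.1, fun hv =>
          hu.2 (kempeClosed_iff.1 (kempeClosed_kempeComponent w) v u h.symm hv)⟩
      have hlt : (U \ K).ncard < n := hn ▸ Set.ncard_lt_ncard
        ⟨Set.sdiff_subset, fun h => (h hw).2 hwK⟩ (Set.toFinite U)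
      have heq : swapOn (swapOn c α β K) α β (U \ K) = swapOn c α β U := by
        funext v
        by_cases hvK : v ∈ K
        · rw [swapOn_of_notMem (fun h => h.2 hvK), swapOn_of_mem hvK, swapOn_of_mem (hKU hvK)]
        · by_cases hvU : v ∈ U
          · rw [swapOn_of_mem (Set.mem_sdiff_of_mem hvU hvK), swapOn_of_notMem hvK, swapOn_of_mem hvU]
          · rw [swapOn_of_notMem (fun h => hvU h.1), swapOn_of_notMem hvK,
              swapOn_of_notMem hvU]
      exact heq ▸ Relation.ReflTransGen.head (kempeStep_iff.2 ⟨α, β, w, rfl⟩)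
        (ih _ hlt hclosed rfl)

lemma KempeClosed.proper (hU : KempeClosed G c α β U) (hc : Proper G c) :
    Proper G (swapOn c α β U) := by
  have key : ∀ ⦃u v⦄, G.Adj u v → u ∈ U → v ∉ U → Equiv.swap α β (c u) ≠ c v := by
    intro u v h hu hv heq
    by_cases hcv : c v = α ∨ c v = β
    · exact hv (hU h ((swap_eq_or_iff _).1 (heq ▸ hcv)) hcv hu)
    · rw [Equiv.swap_apply_eq_iff, Equiv.swap_apply_of_ne_of_ne (fun h => hcv (.inl h))
        (fun h => hcv (.inr h))] at heq
      exact hc h heq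
  intro u v h
  by_cases hu : u ∈ U <;> by_cases hv : v ∈ U
  · rw [swapOn_of_mem hu, swapOn_of_mem hv]
    exact fun heq => hc h ((Equiv.swap α β).injective heq)
  · rw [swapOn_of_mem hu, swapOn_of_notMem hv]
    exact key h hu hv
  · rw [swapOn_of_notMem hu, swapOn_of_mem hv]
    exact (key h.symm hv hu).symm
  · rw [swapOn_of_notMem hu, swapOn_of_notMem hv]
    exact hc h

open Classical in
/-- A vertex may be recolored with any color missing from its neighborhood. -/
lemma recolor [Finite V] (hc : Proper G c) {v : V} {γ : Fin k} (hγ : ∀ u, G.Adj v u → c u ≠ γ) :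
    KempeEquiv G c (Function.update c v γ) ∧ Proper G (Function.update c v γ) := by
  have hclosed : KempeClosed G c (c v) γ {v} := by
    rintro u w h - hw rfl
    exact absurd hw (not_or.2 ⟨(hc h).symm, hγ w h⟩)
  have heq : swapOn c (c v) γ {v} = Function.update c v γ := by
    funext u
    by_cases hu : u = v
    · subst hu
      rw [swapOn_of_mem (Set.mem_singleton u), Equiv.swap_apply_left, Function.update_self]
    · rw [swapOn_of_notMem (Set.notMem_singleton_iff.2 hu), Function.update_of_ne hu]
  exact heq ▸ ⟨hclosed.kempeEquiv, hclosed.proper hc⟩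

/-- Kempe equivalences pull back along maps that send edges to edges or collapse them. -/
lemma KempeEquiv.comp [Finite V] {W : Type*} {H : SimpleGraph W} {q : V → W}
    (hq : ∀ ⦃u v⦄, G.Adj u v → q u ≠ q v → H.Adj (q u) (q v)) {c₁ c₂ : W → Fin k}
    (h : KempeEquiv H c₁ c₂) : KempeEquiv G (c₁ ∘ q) (c₂ ∘ q) := by
  induction h with
  | refl => exact .refl
  | @tail d e _ hs ih =>
    obtain ⟨α, β, w, rfl⟩ := kempeStep_iff.1 hs
    have hclosed : KempeClosed G (d ∘ q) α β (q ⁻¹' kempeComponent H d α β w) := by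
      intro u v h hu hv hmem
      by_cases huv : q u = q v
      · rwa [Set.mem_preimage, ← huv]
      · exact kempeClosed_kempeComponent w (hq h huv) hu hv hmem
    have heq : swapOn (d ∘ q) α β (q ⁻¹' kempeComponent H d α β w) =
        swapOn d α β (kempeComponent H d α β w) ∘ q := by
      rfl
    exact ih.trans (heq ▸ hclosed.kempeEquiv)

/-! ### Colorings of degenerate graphs -/

/-- A Kempe step away from a vertex of small degree can be carried out in the whole graph. -/
lemma KempeStep.lift [Finite V] {v : V} (hHG : ∀ ⦃x y⦄, G.Adj x y → x ≠ v → y ≠ v → H.Adj x y)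
    (hv : (G.neighborSet v).ncard < k) {c d e : V → Fin k} (hc : Proper G c)
    (hcd : ∀ u, u ≠ v → c u = d u) (hs : KempeStep H d e) :
    ∃ c', Proper G c' ∧ KempeEquiv G c c' ∧ ∀ u, u ≠ v → c' u = e u := by
  classical
  obtain ⟨α, β, w, rfl⟩ := kempeStep_iff.1 hs
  set K := kempeComponent H d α β w
  have hK : KempeClosed H d α β K := kempeClosed_kempeComponent w
  have agree : ∀ (c : V → Fin k) (U : Set V), (∀ u, u ≠ v → c u = d u) →
      (∀ u, u ≠ v → (u ∈ U ↔ u ∈ K)) → ∀ u, u ≠ v → swapOn c α β U u = swapOn d α β K u := by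
    intro c U hcd hU u hu
    simp only [swapOn, hU u hu, hcd u hu]
  -- the color of `v` does not take part in the swap
  have main : ∀ c : V → Fin k, Proper G c → (∀ u, u ≠ v → c u = d u) → ¬ (c v = α ∨ c v = β) →
      ∃ c', Proper G c' ∧ KempeEquiv G c c' ∧ ∀ u, u ≠ v → c' u = swapOn d α β K u := by
    intro c hc hcd hcv
    have hclosed : KempeClosed G c α β K := by
      intro x y h hx hy hmem
      have hxv : x ≠ v := by rintro rfl; exact hcv hx
      have hyv : y ≠ v := by rintro rfl; exact hcv hy
      exact hK (hHG h hxv hyv) (hcd x hxv ▸ hx) (hcd y hyv ▸ hy) hmem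
    exact ⟨_, hclosed.proper hc, hclosed.kempeEquiv, agree c K hcd fun _ _ => Iff.rfl⟩
  by_cases hcv : c v = α ∨ c v = β
  swap
  · exact main c hc hcd hcv
  by_cases hin : ∀ u, G.Adj v u → (c u = α ∨ c u = β) → u ∈ K
  · have hclosed : KempeClosed G c α β (insert v K) := by
      intro x y h hx hy hmem
      by_cases hyv : y = v
      · exact Or.inl hyv
      by_cases hxv : x = v
      · exact Or.inr (hin y (hxv ▸ h) hy)
      · exact Or.inr (hK (hHG h hxv hyv) (hcd x hxv ▸ hx) (hcd y hyv ▸ hy)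
          (hmem.resolve_left hxv))
    exact ⟨_, hclosed.proper hc, hclosed.kempeEquiv,
      agree c _ hcd fun u hu => by simp [hu]⟩
  by_cases hout : ∀ u, G.Adj v u → (c u = α ∨ c u = β) → u ∉ K
  · have hclosed : KempeClosed G c α β (K \ {v}) := by
      intro x y h hx hy hmem
      by_cases hyv : y = v
      · exact absurd hmem.1 (hout x (hyv ▸ h.symm) hx)
      · exact ⟨hK (hHG h hmem.2 hyv) (hcd x hmem.2 ▸ hx) (hcd y hyv ▸ hy) hmem.1, hyv⟩
    exact ⟨_, hclosed.proper hc, hclosed.kempeEquiv,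
      agree c _ hcd fun u hu => by simp [hu]⟩
  -- two neighbors of `v` share a color, so `v` can first be recolored
  push Not at hin hout
  obtain ⟨y, hvy, hcy, hyK⟩ := hin
  obtain ⟨x, hvx, hcx, hxK⟩ := hout
  have hxy : x ≠ y := by rintro rfl; exact hyK hxK
  have hcxy : c x = c y := by
    have h₁ := hc hvx
    have h₂ := hc hvy
    grind
  set N : Finset V := (Set.toFinite (G.neighborSet v)).toFinset
  have hN : N.card < k := by rwa [← Set.ncard_eq_toFinset_card]
  have memN : ∀ u, u ∈ N ↔ G.Adj v u := fun u => by simp [N]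
  obtain ⟨γ, hγ⟩ : ∃ γ, γ ∉ insert (c v) ((N.erase x).image c) := by
    by_contra! hall
    have h₁ : (insert (c v) ((N.erase x).image c)).card = k := by
      rw [Finset.eq_univ_iff_forall.2 hall, Finset.card_univ, Fintype.card_fin]
    have h₂ := Finset.card_insert_le (c v) ((N.erase x).image c)
    have h₃ : ((N.erase x).image c).card ≤ (N.erase x).card := Finset.card_image_le
    have h₄ := Finset.card_erase_add_one ((memN x).2 hvx)
    omega
  have hγN : ∀ u, G.Adj v u → c u ≠ γ := by
    rintro u hu rfl
    refine hγ (Finset.mem_insert_of_mem ?_)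
    by_cases hux : u = x
    · exact Finset.mem_image.2 ⟨y, Finset.mem_erase.2 ⟨hxy.symm, (memN y).2 hvy⟩, by
        rw [hux, hcxy]⟩
    · exact Finset.mem_image_of_mem _ (Finset.mem_erase.2 ⟨hux, (memN u).2 hu⟩)
  have hγv : γ ≠ c v := fun h => hγ (h ▸ Finset.mem_insert_self _ _)
  obtain ⟨hequiv, hproper⟩ := recolor hc hγN
  obtain ⟨c', h₁, h₂, h₃⟩ := main (Function.update c v γ) hproper
    (fun u hu => by rw [Function.update_of_ne hu, hcd u hu])
    (by
      rw [Function.update_self]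
      have h₁ := hc hvy
      have h₂ := hγN y hvy
      grind)
  exact ⟨c', h₁, hequiv.trans h₂, h₃⟩

lemma KempeEquiv.lift [Finite V] {v : V} (hHG : ∀ ⦃x y⦄, G.Adj x y → x ≠ v → y ≠ v → H.Adj x y)
    (hv : (G.neighborSet v).ncard < k) {c d e : V → Fin k} (hc : Proper G c)
    (hcd : ∀ u, u ≠ v → c u = d u) (h : KempeEquiv H d e) :
    ∃ c', Proper G c' ∧ KempeEquiv G c c' ∧ ∀ u, u ≠ v → c' u = e u := by
  induction h with
  | refl => exact ⟨c, hc, .refl, hcd⟩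
  | tail _ hs ih =>
    obtain ⟨c₁, hc₁, hcc₁, hc₁d⟩ := ih
    obtain ⟨c₂, hc₂, hcc₂, hc₂e⟩ := hs.lift hHG hv hc₁ hc₁d
    exact ⟨c₂, hc₂, hcc₁.trans hcc₂, hc₂e⟩

/-- The edges of `G` with both ends in `A`. -/
def edgesWithin (G : SimpleGraph V) (A : Set V) : SimpleGraph V where
  Adj u v := G.Adj u v ∧ u ∈ A ∧ v ∈ A
  symm := ⟨fun _ _ h => ⟨h.1.symm, h.2.2, h.2.1⟩⟩
  loopless := ⟨fun _ h => h.1.ne rfl⟩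

lemma kempeEquiv_edgesWithin [Finite V] {d : ℕ} (hG : Degenerate G d) (hd : d < k) (A : Set V)
    {c₁ c₂ : V → Fin k} (h₁ : Proper (edgesWithin G A) c₁) (h₂ : Proper (edgesWithin G A) c₂)
    (h : ∀ v, v ∉ A → c₁ v = c₂ v) : KempeEquiv (edgesWithin G A) c₁ c₂ := by
  classical
  induction hn : A.ncard using Nat.strong_induction_on generalizing A c₁ with
  | _ n ih =>
    rcases A.eq_empty_or_nonempty with rfl | hA
    · rw [funext fun v => h v (Set.notMem_empty v)]
      exact .refl
    obtain ⟨v, hvA, hv⟩ := hG A (Set.toFinite A) hA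
    have hN : (edgesWithin G A).neighborSet v ⊆ A ∩ G.neighborSet v := fun u hu => ⟨hu.2.2, hu.1⟩
    have hcard : ((edgesWithin G A).neighborSet v).ncard < k :=
      ((Set.ncard_le_ncard hN (Set.toFinite _)).trans hv).trans_lt hd
    have hHG : ∀ ⦃x y⦄, (edgesWithin G A).Adj x y → x ≠ v → y ≠ v →
        (edgesWithin G (A \ {v})).Adj x y :=
      fun x y h hx hy => ⟨h.1, ⟨h.2.1, hx⟩, ⟨h.2.2, hy⟩⟩
    have hsub : ∀ ⦃x y⦄, (edgesWithin G (A \ {v})).Adj x y → (edgesWithin G A).Adj x y :=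
      fun x y h => ⟨h.1, h.2.1.1, h.2.2.1⟩
    have hequiv : KempeEquiv (edgesWithin G (A \ {v})) (Function.update c₁ v (c₂ v)) c₂ := by
      refine ih _ (hn ▸ Set.ncard_sdiff_singleton_lt_of_mem hvA) (A \ {v}) ?_
        (fun x y h => h₂ (hsub h)) ?_ rfl
      · intro x y hxy
        rw [Function.update_of_ne hxy.2.1.2, Function.update_of_ne hxy.2.2.2]
        exact h₁ (hsub hxy)
      · intro u hu
        by_cases huv : u = v
        · rw [huv, Function.update_self]
        · rw [Function.update_of_ne huv, h u fun huA => hu ⟨huA, huv⟩]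
    obtain ⟨c, hc, hc₁, hc₂⟩ : ∃ c, Proper (edgesWithin G A) c ∧
        KempeEquiv (edgesWithin G A) c₁ c ∧ ∀ u, u ≠ v → c u = c₂ u :=
      hequiv.lift hHG hcard h₁ fun u hu => by rw [Function.update_of_ne hu]
    have heq : Function.update c v (c₂ v) = c₂ := by
      funext u
      by_cases huv : u = v
      · rw [huv, Function.update_self]
      · rw [Function.update_of_ne huv, hc₂ u huv]
    have hlast := recolor hc (v := v) (γ := c₂ v) fun u hu => by
      rw [hc₂ u hu.ne']
      exact (h₂ hu).symm
    exact hc₁.trans (heq ▸ hlast.1)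

/-- The Las Vergnas–Meyniel theorem: all `k`-colorings of a `d`-degenerate graph with `d < k`
are Kempe `k`-equivalent. -/
theorem Degenerate.kempeEquiv [Finite V] {d : ℕ} (hG : Degenerate G d) (hd : d < k)
    {c₁ c₂ : V → Fin k} (h₁ : Proper G c₁) (h₂ : Proper G c₂) : KempeEquiv G c₁ c₂ := by
  have hGU : edgesWithin G Set.univ = G := by
    ext u v
    simp [edgesWithin]
  have h := kempeEquiv_edgesWithin hG hd Set.univ (hGU.symm ▸ h₁) (hGU.symm ▸ h₂)
    fun v hv => absurd (Set.mem_univ v) hv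
  rwa [hGU] at h

/-! ### Identifications -/

lemma mk_identifyRel_eq_iff {S : Set V} {u v : V} :
    Quot.mk (identifyRel S) u = Quot.mk (identifyRel S) v ↔ identifyRel S u v := by
  refine ⟨fun h => ?_, Quot.sound⟩
  refine (Equivalence.quot_mk_eq_iff ⟨fun x => .inl rfl, ?_, ?_⟩ u v).1 h
  · rintro x y (rfl | ⟨hx, hy⟩)
    exacts [.inl rfl, .inr ⟨hy, hx⟩]
  · rintro x y z (rfl | ⟨hx, hy⟩) (rfl | ⟨hy', hz⟩)
    exacts [.inl rfl, .inr ⟨hy', hz⟩, .inr ⟨hx, hy⟩, .inr ⟨hx, hz⟩]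

lemma identify_adj {S : Set V} {x y : Quot (identifyRel S)} :
    (Identify G S).Adj x y ↔ x ≠ y ∧
      ∃ u v, Quot.mk (identifyRel S) u = x ∧ Quot.mk (identifyRel S) v = y ∧ G.Adj u v := by
  rw [Identify, SimpleGraph.fromRel_adj]
  refine and_congr_right fun _ => ⟨?_, Or.inl⟩
  rintro (h | ⟨u, v, hu, hv, h⟩)
  exacts [h, ⟨v, u, hv, hu, h.symm⟩]

/-- All proper colorings that are constant on a set with `d`-degenerate identification are
Kempe `k`-equivalent when `d < k`. -/
lemma kempeEquiv_of_degenerate_identify [Finite V] {S : Set V} {d : ℕ}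
    (hS : Degenerate (Identify G S) d) (hd : d < k) {c₁ c₂ : V → Fin k}
    (h₁ : Proper G c₁) (h₂ : Proper G c₂) (m₁ : Mono c₁ S) (m₂ : Mono c₂ S) :
    KempeEquiv G c₁ c₂ := by
  have lift : ∀ c : V → Fin k, Proper G c → Mono c S →
      ∃ f : Quot (identifyRel S) → Fin k, Proper (Identify G S) f ∧
        c = f ∘ Quot.mk (identifyRel S) := by
    intro c hc hm
    refine ⟨Quot.lift c ?_, ?_, rfl⟩
    · rintro u v (rfl | ⟨hu, hv⟩)
      exacts [rfl, hm u hu v hv]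
    · intro x y hxy
      obtain ⟨-, u, v, rfl, rfl, h⟩ := identify_adj.1 hxy
      exact hc h
  obtain ⟨f₁, hf₁, rfl⟩ := lift c₁ h₁ m₁
  obtain ⟨f₂, hf₂, rfl⟩ := lift c₂ h₂ m₂
  exact (hS.kempeEquiv hd hf₁ hf₂).comp fun u v h hne => identify_adj.2 ⟨hne, u, v, rfl, rfl, h⟩

/-- If the vertices outside `S` can be ranked so that each of them has, after identifying `S`,
at most `d` neighbors that lie in `S` or have at least its rank, then the identification is
`d`-degenerate. -/
lemma degenerate_identify [Finite V] {S : Set V} {d : ℕ} (r : V → ℕ)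
    (h : ∀ v, v ∉ S → ∃ F : Finset V, F.card ≤ d ∧
      ∀ u, G.Adj v u → (u ∈ S ∨ r v ≤ r u) → ∃ w ∈ F, identifyRel S w u) :
    Degenerate (Identify G S) d := by
  classical
  intro A _ hA
  by_cases hex : {v | v ∉ S ∧ Quot.mk (identifyRel S) v ∈ A}.Nonempty
  · obtain ⟨v, ⟨hvS, hvA⟩, hmin⟩ := Set.exists_min_image _ r (Set.toFinite _) hex
    refine ⟨_, hvA, ?_⟩
    obtain ⟨F, hF, hFu⟩ := h v hvS
    refine le_trans (Set.ncard_le_ncard (t := F.image (Quot.mk (identifyRel S))) ?_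
      (Set.toFinite _)) ?_
    · rintro y ⟨hyA, hy⟩
      obtain ⟨-, v', u, hv', rfl, hadj⟩ := identify_adj.1 hy
      obtain rfl : v' = v := (mk_identifyRel_eq_iff.1 hv').resolve_right fun h => hvS h.2
      have hu : u ∈ S ∨ r v' ≤ r u := by
        by_cases huS : u ∈ S
        · exact .inl huS
        · exact .inr (hmin u ⟨huS, hyA⟩)
      obtain ⟨w, hw, hwu⟩ := hFu u hadj hu
      exact Finset.mem_coe.2 (Finset.mem_image.2 ⟨w, hw, Quot.sound hwu⟩)
    · rw [Set.ncard_coe_finset]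
      exact Finset.card_image_le.trans hF
  · have hAS : ∀ v, Quot.mk (identifyRel S) v ∈ A → v ∈ S := fun v hv => by
      by_contra hvS
      exact hex ⟨v, hvS, hv⟩
    obtain ⟨x, hx⟩ := hA
    refine ⟨x, hx, ?_⟩
    have hempty : A ∩ (Identify G S).neighborSet x = ∅ := by
      refine Set.eq_empty_of_forall_notMem ?_
      rintro y ⟨hyA, hy⟩
      obtain ⟨hne, u, v, rfl, rfl, -⟩ := identify_adj.1 hy
      exact hne (Quot.sound (.inr ⟨hAS u hx, hAS v hyA⟩))
    rw [hempty, Set.ncard_empty]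
    exact Nat.zero_le d

open Classical in
/-- If the identification of `S` in an `n`-regular graph is `d`-degenerate, then some vertex
has more than `n - d` neighbors in `S`. -/
lemma exists_card_neighbors [Finite V] [Nonempty V] {S : Set V} {d n : ℕ} (hI : Indep G S)
    (hS : Degenerate (Identify G S) d) (hdn : d < n) (N : V → Finset V)
    (hN : ∀ v u, u ∈ N v ↔ G.Adj v u) (hn : ∀ v, (N v).card = n) :
    ∃ v, n < ((N v).filter (· ∈ S)).card + d := by
  obtain ⟨x, -, hx⟩ := hS Set.univ (Set.toFinite _)
    ⟨Quot.mk _ (Classical.arbitrary V), Set.mem_univ _⟩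
  obtain ⟨v, rfl⟩ := Quot.exists_rep x
  refine ⟨v, ?_⟩
  rw [Set.univ_inter] at hx
  have hadj : ∀ u ∈ N v, (Identify G S).Adj (Quot.mk _ v) (Quot.mk _ u) := fun u hu => by
    have hvu := (hN v u).1 hu
    refine identify_adj.2 ⟨fun heq => ?_, v, u, rfl, rfl, hvu⟩
    rcases mk_identifyRel_eq_iff.1 heq with rfl | ⟨h₁, h₂⟩
    exacts [hvu.ne rfl, hI _ h₁ _ h₂ hvu]
  have bound : ∀ F ⊆ N v, (∀ u ∈ F, ∀ w ∈ F, u ∈ S → w ∈ S → u = w) → F.card ≤ d := by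
    intro F hF hinj
    rw [← Finset.card_image_of_injOn (f := Quot.mk (identifyRel S)) (s := F),
      ← Set.ncard_coe_finset]
    · refine le_trans (Set.ncard_le_ncard ?_ (Set.toFinite _)) hx
      intro y hy
      obtain ⟨u, hu, rfl⟩ := Finset.mem_image.1 (Finset.mem_coe.1 hy)
      exact hadj u (hF hu)
    · intro u hu w hw heq
      rcases mk_identifyRel_eq_iff.1 heq with h | ⟨h₁, h₂⟩
      exacts [h, hinj u hu w hw h₁ h₂]
  have hsplit := Finset.card_filter_add_card_filter_not (s := N v) (· ∈ S)
  rw [hn] at hsplit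
  rcases ((N v).filter (· ∈ S)).eq_empty_or_nonempty with he | ⟨s, hs⟩
  · have h₁ := bound ((N v).filter (· ∉ S)) (Finset.filter_subset _ _) fun u hu _ _ h =>
      absurd h (Finset.mem_filter.1 hu).2
    rw [he, Finset.card_empty] at hsplit
    omega
  · have hs' := Finset.mem_filter.1 hs
    have h₁ := bound (insert s ((N v).filter (· ∉ S)))
      (Finset.insert_subset hs'.1 (Finset.filter_subset _ _)) fun u hu w hw hu' hw' => by
        simp only [Finset.mem_insert, Finset.mem_filter] at hu hw
        grind
    rw [Finset.card_insert_of_notMem (by simp [hs'.2])] at h₁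
    omega

end Kempe

/-! ### The circulant graph -/

/-- The connection set of `circulant37`. -/
def steps : Finset (ZMod 37) := {1, -1, 10, -10, 11, -11}

lemma circulant37_adj {u v : ZMod 37} : circulant37.Adj u v ↔ v - u ∈ steps := by
  have hneg : ∀ x : ZMod 37, x ∈ steps → x ≠ 0 ∧ -x ∈ steps := by decide +kernel
  have hmem : ∀ x : ZMod 37, x ∈ ({1, -1, 10, -10, 11, -11} : Set (ZMod 37)) ↔ x ∈ steps := by
    simp [steps]
  rw [circulant37, SimpleGraph.fromRel_adj, hmem, hmem]
  constructor
  · rintro ⟨-, h | h⟩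
    exacts [neg_sub u v ▸ (hneg _ h).2, h]
  · exact fun h => ⟨fun huv => (hneg _ h).1 (huv ▸ sub_self v), Or.inr h⟩

lemma proper_circulant37 {k : ℕ} {c : ZMod 37 → Fin k}
    (h : ∀ u, ∀ s ∈ steps, c u ≠ c (u + s)) : Proper circulant37 c := fun u v huv => by
  simpa using h u (v - u) (circulant37_adj.1 huv)

/-- The affine map `u ↦ ε * u + b`. -/
def affine (ε b u : ZMod 37) : ZMod 37 := ε * u + b

lemma affine_adj {ε : ZMod 37} (hε : ε = 1 ∨ ε = -1) (b : ZMod 37) {u v : ZMod 37} :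
    circulant37.Adj (affine ε b u) (affine ε b v) ↔ circulant37.Adj u v := by
  have hneg : ∀ x : ZMod 37, -x ∈ steps ↔ x ∈ steps := by decide +kernel
  simp only [circulant37_adj, affine, add_sub_add_right_eq_sub, ← mul_sub]
  rcases hε with rfl | rfl
  · rw [one_mul]
  · rw [neg_one_mul, hneg]

lemma Proper.comp_affine {k : ℕ} {c : ZMod 37 → Fin k} (hc : Proper circulant37 c)
    {ε : ZMod 37} (hε : ε = 1 ∨ ε = -1) (b : ZMod 37) :
    Proper circulant37 (c ∘ affine ε b) :=
  fun _ _ h => hc ((affine_adj hε b).2 h)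

lemma KempeEquiv.comp_affine {k : ℕ} {c₁ c₂ : ZMod 37 → Fin k}
    (h : KempeEquiv circulant37 c₁ c₂) {ε : ZMod 37} (hε : ε = 1 ∨ ε = -1) (b : ZMod 37) :
    KempeEquiv circulant37 (c₁ ∘ affine ε b) (c₂ ∘ affine ε b) :=
  h.comp fun _ _ huv _ => (affine_adj hε b).2 huv

/-- A good 4-template contains every other neighbor of some vertex. -/
lemma GoodFourTemplate.exists_neighbors {S : Set (ZMod 37)}
    (hS : GoodFourTemplate circulant37 S) :
    ∃ v ε : ZMod 37, (ε = 1 ∨ ε = -1) ∧ v + ε ∈ S ∧ v + ε * 10 ∈ S ∧ v - ε * 11 ∈ S := by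
  classical
  obtain ⟨hI, -, hdeg⟩ := hS
  obtain ⟨v, hv⟩ := exists_card_neighbors (n := 6) hI hdeg (by norm_num)
    (fun v => steps.map (addLeftEmbedding v))
    (fun v u => by
      simp only [Finset.mem_map, addLeftEmbedding_apply, circulant37_adj]
      exact ⟨by rintro ⟨s, hs, rfl⟩; simpa using hs, fun h => ⟨_, h, by ring⟩⟩)
    (fun v => by rw [Finset.card_map]; decide +kernel)
  rw [Finset.filter_map, Finset.card_map] at hv
  set p : ZMod 37 → Prop := fun x => v + x ∈ S with hp
  replace hv : 3 ≤ (steps.filter p).card := by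
    change 6 < (steps.filter p).card + 4 at hv
    omega
  have hpp : ∀ x y, y - x ∈ steps → ¬ (p x ∧ p y) := fun x y hxy h =>
    hI _ h.1 _ h.2 (circulant37_adj.2 (by rwa [add_sub_add_left_eq_sub]))
  have e₁ := hpp 1 11 (by decide +kernel)
  have e₂ := hpp 11 10 (by decide +kernel)
  have e₃ := hpp 10 (-1) (by decide +kernel)
  have e₄ := hpp (-1) (-11) (by decide +kernel)
  have e₅ := hpp (-11) (-10) (by decide +kernel)
  have e₆ := hpp (-10) 1 (by decide +kernel)
  have hsum : ∀ f : ZMod 37 → ℕ, ∑ x ∈ steps, f x =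
      f 1 + (f (-1) + (f 10 + (f (-10) + (f 11 + f (-11))))) := fun f => by
    rw [steps, Finset.sum_insert (by decide +kernel), Finset.sum_insert (by decide +kernel),
      Finset.sum_insert (by decide +kernel), Finset.sum_insert (by decide +kernel),
      Finset.sum_insert (by decide +kernel), Finset.sum_singleton]
  rw [Finset.card_filter, hsum] at hv
  have halt : (p 1 ∧ p 10 ∧ p (-11)) ∨ (p (-1) ∧ p (-10) ∧ p 11) := by
    simp only [hp] at e₁ e₂ e₃ e₄ e₅ e₆ ⊢
    clear hpp hsum hI
    split_ifs at hv <;> simp_all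
  rcases halt with ⟨h₁, h₂, h₃⟩ | ⟨h₁, h₂, h₃⟩
  · exact ⟨v, 1, .inl rfl, h₁, by rwa [one_mul], by rwa [one_mul, sub_eq_add_neg]⟩
  · exact ⟨v, -1, .inr rfl, h₁, by rwa [neg_one_mul], by rwa [neg_one_mul, sub_neg_eq_add]⟩

/-- A reference good 4-template. -/
def baseTemplate : Finset (ZMod 37) := {1, 6, 10, 26}

/-- The position of each vertex outside `baseTemplate` in an elimination order of the
identification. -/
def eliminationRank : ZMod 37 → ℕ :=
  show Fin 37 → ℕ from
    ![0, 0, 10, 13, 19, 27, 0, 8, 11, 14, 0, 1, 15, 20, 28, 29, 4, 5, 7, 12, 21, 30, 22, 23, 24,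
      25, 0, 2, 6, 9, 16, 31, 32, 26, 17, 18, 3]

lemma degenerate_identify_baseTemplate :
    Degenerate (Identify circulant37 (baseTemplate : Set (ZMod 37))) 4 := by
  refine degenerate_identify eliminationRank fun v hv =>
    ⟨((steps.image (v + ·)).filter fun u => u ∈ baseTemplate ∨
      eliminationRank v ≤ eliminationRank u).image fun u => if u ∈ baseTemplate then 1 else u,
      ?_, fun u hu hur => ?_⟩
  · have h : ∀ v : ZMod 37, v ∉ baseTemplate →
        (((steps.image (v + ·)).filter fun u => u ∈ baseTemplate ∨
          eliminationRank v ≤ eliminationRank u).image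
            fun u => if u ∈ baseTemplate then 1 else u).card ≤ 4 := by
      decide +kernel
    exact h v hv
  · refine ⟨_, Finset.mem_image_of_mem _ (Finset.mem_filter.2 ⟨Finset.mem_image.2
      ⟨u - v, circulant37_adj.1 hu, add_sub_cancel v u⟩, hur⟩), ?_⟩
    by_cases hub : u ∈ baseTemplate
    · rw [if_pos hub]
      exact .inr ⟨by simp [baseTemplate], hub⟩
    · rw [if_neg hub]
      exact .inl rfl

lemma kempeEquiv_of_baseTemplate {c₁ c₂ : ZMod 37 → Fin 5} (h₁ : Proper circulant37 c₁)
    (h₂ : Proper circulant37 c₂) (m₁ : ∀ u ∈ baseTemplate, ∀ v ∈ baseTemplate, c₁ u = c₁ v)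
    (m₂ : ∀ u ∈ baseTemplate, ∀ v ∈ baseTemplate, c₂ u = c₂ v) :
    KempeEquiv circulant37 c₁ c₂ :=
  kempeEquiv_of_degenerate_identify degenerate_identify_baseTemplate (by norm_num) h₁ h₂ m₁ m₂

/-- A coloring that contains `baseTemplate`, its translate by `1` and its negative. -/
def baseColoring : ZMod 37 → Fin 5 :=
  show Fin 37 → Fin 5 from
    ![2, 1, 0, 3, 4, 2, 1, 0, 3, 2, 1, 0, 4, 2, 1, 0, 3, 2, 1, 0, 3, 2, 1, 3, 0, 2, 1, 0, 3, 2, 1,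
      0, 3, 2, 1, 4, 0]

lemma proper_baseColoring : Proper circulant37 baseColoring :=
  proper_circulant37 (by decide +kernel)

lemma baseColoring_comp_affine {ε : ZMod 37} (hε : ε = 1 ∨ ε = -1) (b : ZMod 37) :
    KempeEquiv circulant37 (baseColoring ∘ affine ε b) baseColoring := by
  have hshift : KempeEquiv circulant37 (baseColoring ∘ affine 1 1) baseColoring :=
    kempeEquiv_of_baseTemplate (proper_baseColoring.comp_affine (.inl rfl) 1)
      proper_baseColoring (by decide +kernel) (by decide +kernel)
  have hneg : KempeEquiv circulant37 (baseColoring ∘ affine (-1) 0) baseColoring :=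
    kempeEquiv_of_baseTemplate (proper_baseColoring.comp_affine (.inr rfl) 0)
      proper_baseColoring (by decide +kernel) (by decide +kernel)
  have htrans : ∀ n : ℕ, KempeEquiv circulant37 (baseColoring ∘ affine 1 n) baseColoring := by
    intro n
    induction n with
    | zero =>
      rw [show affine 1 ((0 : ℕ) : ZMod 37) = id from funext fun u => by simp [affine]]
      exact .refl
    | succ n ih =>
      rw [show affine 1 ((n + 1 : ℕ) : ZMod 37) = affine 1 1 ∘ affine 1 n from
        funext fun u => by simp [affine, add_assoc]]
      exact (hshift.comp_affine (.inl rfl) n).trans ih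
  rcases hε with rfl | rfl
  · exact ZMod.natCast_zmod_val b ▸ htrans b.val
  · have h := (hneg.comp_affine (.inl rfl) (-b)).trans
      (ZMod.natCast_zmod_val (-b) ▸ htrans (-b).val)
    rwa [Function.comp_assoc, show affine (-1) 0 ∘ affine 1 (-b) = affine (-1) b from
      funext fun u => by simp [affine, add_comm]] at h

/-- Colorings that contain `baseTemplate` and, between them, every independent set obtained by
adding a vertex to `{4, 13, 29}`. -/
def linkColoring : Fin 4 → ZMod 37 → Fin 5 :=
  show Fin 4 → Fin 37 → Fin 5 from
    ![![1, 0, 3, 1, 0, 1, 0, 2, 0, 3, 0, 2, 1, 0, 2, 3, 2, 1, 3, 1, 2, 1, 0, 2, 3, 1, 0, 3, 2, 0,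
        4, 3, 2, 3, 1, 2, 4],
      ![2, 1, 3, 1, 0, 3, 1, 0, 2, 0, 1, 0, 2, 0, 3, 2, 0, 3, 4, 1, 2, 3, 1, 3, 2, 0, 1, 4, 2, 0,
        3, 1, 0, 2, 1, 3, 4],
      ![0, 1, 3, 2, 0, 2, 1, 2, 3, 2, 1, 3, 2, 0, 1, 3, 4, 0, 1, 4, 0, 2, 1, 3, 4, 2, 1, 3, 2, 0,
        3, 1, 3, 0, 1, 0, 3],
      ![2, 1, 3, 2, 0, 2, 1, 3, 2, 3, 1, 3, 2, 0, 1, 3, 4, 2, 1, 4, 2, 0, 1, 3, 4, 2, 1, 0, 4, 0,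
        1, 4, 3, 2, 0, 1, 0]]

lemma exists_linkColoring : ∀ y : ZMod 37,
    y ∉ ({4, 13, 29} : Finset (ZMod 37)) →
    (∀ x ∈ ({4, 13, 29} : Finset (ZMod 37)), y - x ∉ steps) →
    ∃ i, linkColoring i 4 = linkColoring i y ∧ linkColoring i 13 = linkColoring i y ∧
      linkColoring i 29 = linkColoring i y := by
  decide +kernel

lemma proper_linkColoring (i : Fin 4) : Proper circulant37 (linkColoring i) := by
  have h : ∀ i, ∀ u, ∀ s ∈ steps, linkColoring i u ≠ linkColoring i (u + s) := by decide +kernel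
  exact proper_circulant37 (h i)

lemma kempeEquiv_linkColoring (i : Fin 4) :
    KempeEquiv circulant37 (linkColoring i) baseColoring := by
  have h : ∀ i, ∀ u ∈ baseTemplate, ∀ v ∈ baseTemplate,
      linkColoring i u = linkColoring i v := by
    decide +kernel
  exact kempeEquiv_of_baseTemplate (proper_linkColoring i) proper_baseColoring (h i)
    (by decide +kernel)

/-- Every proper coloring with a good 4-template is equivalent to the reference coloring. -/
lemma kempeEquiv_baseColoring {φ : ZMod 37 → Fin 5} (hφ : Proper circulant37 φ)
    {S : Set (ZMod 37)} (hS : GoodFourTemplate circulant37 S) (hm : Mono φ S) :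
    KempeEquiv circulant37 φ baseColoring := by
  obtain ⟨v, ε, hε, h₁, h₂, h₃⟩ := hS.exists_neighbors
  obtain ⟨hI, hcard, hdeg⟩ := hS
  have hεε : ε * ε = 1 := by rcases hε with rfl | rfl <;> simp
  set g := affine ε (3 - ε * v) with hg
  have g₁ : g (v + ε) = 4 := by simp only [hg, affine]; linear_combination hεε
  have g₂ : g (v + ε * 10) = 13 := by simp only [hg, affine]; linear_combination 10 * hεε
  have g₃ : g (v - ε * 11) = 29 := by
    have h37 : (37 : ZMod 37) = 0 := by decide +kernel
    simp only [hg, affine]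
    linear_combination -11 * hεε - h37
  have hinj : Function.Injective g := fun a b hab => by
    have hab' : ε * a = ε * b := add_right_cancel hab
    linear_combination (b - a) * hεε + ε * hab'
  obtain ⟨y, hyS, hy⟩ : ∃ y ∈ S, y ∉ ({v + ε, v + ε * 10, v - ε * 11} : Set (ZMod 37)) := by
    refine Set.exists_mem_notMem_of_ncard_lt_ncard ?_
    rw [hcard]
    have h := Set.ncard_insert_le (v + ε) {v + ε * 10, v - ε * 11}
    have h' := Set.ncard_insert_le (v + ε * 10) {v - ε * 11}
    rw [Set.ncard_singleton] at h'
    omega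
  have hSeq : S = {y, v + ε, v + ε * 10, v - ε * 11} := by
    have hsub : ({y, v + ε, v + ε * 10, v - ε * 11} : Set (ZMod 37)) ⊆ S := by
      rintro x (rfl | rfl | rfl | rfl)
      exacts [hyS, h₁, h₂, h₃]
    refine (Set.eq_of_subset_of_ncard_le hsub ?_ (Set.toFinite _)).symm
    have ne₁ : v + ε ≠ v + ε * 10 := fun h => by
      have := congrArg g h; rw [g₁, g₂] at this; revert this; decide +kernel
    have ne₂ : v + ε ≠ v - ε * 11 := fun h => by
      have := congrArg g h; rw [g₁, g₃] at this; revert this; decide +kernel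
    have ne₃ : v + ε * 10 ≠ v - ε * 11 := fun h => by
      have := congrArg g h; rw [g₂, g₃] at this; revert this; decide +kernel
    rw [Set.ncard_insert_of_notMem hy, Set.ncard_insert_of_notMem (by simp [ne₁, ne₂]),
      Set.ncard_pair ne₃, hcard]
  have hcover : ∀ x ∈ ({4, 13, 29} : Finset (ZMod 37)), ∃ u ∈ S, u ≠ y ∧ g u = x := by
    simp only [Set.mem_insert_iff, Set.mem_singleton_iff, not_or] at hy
    intro x hx
    simp only [Finset.mem_insert, Finset.mem_singleton] at hx
    rcases hx with rfl | rfl | rfl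
    exacts [⟨_, h₁, Ne.symm hy.1, g₁⟩, ⟨_, h₂, Ne.symm hy.2.1, g₂⟩, ⟨_, h₃, Ne.symm hy.2.2, g₃⟩]
  obtain ⟨i, c₁, c₂, c₃⟩ := exists_linkColoring (g y)
    (fun hmem => by
      obtain ⟨u, -, hne, hu⟩ := hcover _ hmem
      exact hne (hinj hu))
    (fun x hx hxy => by
      obtain ⟨u, hu, -, rfl⟩ := hcover _ hx
      exact hI u hu y hyS ((affine_adj hε _).1 (circulant37_adj.2 hxy)))
  have hmono : ∀ u ∈ S, (linkColoring i ∘ g) u = linkColoring i (g y) := by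
    rw [hSeq]
    rintro x (rfl | rfl | rfl | rfl)
    · rfl
    · rw [Function.comp_apply, g₁, c₁]
    · rw [Function.comp_apply, g₂, c₂]
    · rw [Function.comp_apply, g₃, c₃]
  have hφc : KempeEquiv circulant37 φ (linkColoring i ∘ g) :=
    kempeEquiv_of_degenerate_identify hdeg (by norm_num) hφ
      ((proper_linkColoring i).comp_affine hε _) hm
      fun u hu w hw => (hmono u hu).trans (hmono w hw).symm
  exact hφc.trans (((kempeEquiv_linkColoring i).comp_affine hε _).trans
    (baseColoring_comp_affine hε _))

/-- If `φ₁, φ₂` are proper 5-colorings of `C₃₇[1,10,11]` each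
containing a good 4-template, then `φ₁` and `φ₂` are Kempe 5-equivalent. -/
theorem statement_6 (φ₁ φ₂ : ZMod 37 → Fin 5)
    (h₁ : Proper circulant37 φ₁) (h₂ : Proper circulant37 φ₂)
    (S₁ S₂ : Set (ZMod 37))
    (hS₁ : GoodFourTemplate circulant37 S₁) (hS₂ : GoodFourTemplate circulant37 S₂)
    (hc₁ : Mono φ₁ S₁) (hc₂ : Mono φ₂ S₂) :
    KempeEquiv circulant37 φ₁ φ₂ := by
  exact (kempeEquiv_baseColoring h₁ hS₁ hc₁).trans (kempeEquiv_baseColoring h₂ hS₂ hc₂).symm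

end KempePaper
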